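/- arXiv:1807.05706 — 4 statements merged into one kernel-verified Lean document; each statement's English description precedes it below -/
import Mathlib

section
/- The operator ℱ maps C(I, ℓ_p) into C(I, ℓ_p) (i.e. ℱv is a continuous function from I to ℓ_p for every continuous v : I → ℓ_p) and ℱ is continuous on C(I, ℓ_p) with respect to the supremum norm ‖v‖ = sup_{t∈I} ‖v(t)‖_p. -/
open Real Set MeasureTheory intervalIntegral Filter
open scoped ENNReal Topology

/-- The Green's function for the boundary value problem `u'' + u = f`, `u(0) = u(T) = 0`. -/
noncomputable def greenG (T t s : ℝ) : ℝ :=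
  if s ≤ t then Real.sin t * Real.sin (T - s) / Real.sin T
  else Real.sin s * Real.sin (T - t) / Real.sin T

theorem continuous_greenG (T : ℝ) : Continuous fun x : ℝ × ℝ => greenG T x.1 x.2 := by
  unfold greenG
  refine continuous_if_le continuous_snd continuous_fst ?_ ?_ ?_
  · exact Continuous.continuousOn (by fun_prop)
  · exact Continuous.continuousOn (by fun_prop)
  · intro x hx
    simp only [hx]

theorem exists_abs_greenG_le (T : ℝ) :
    ∃ C > 0, ∀ t ∈ Icc 0 T, ∀ s ∈ Icc 0 T, |greenG T t s| ≤ C := by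
  obtain ⟨C, hC⟩ := ((isCompact_Icc (a := (0 : ℝ)) (b := T)).prod
    (isCompact_Icc (a := (0 : ℝ)) (b := T))).exists_bound_of_continuousOn
      (continuous_greenG T).continuousOn
  refine ⟨max C 1, by positivity, fun t ht s hs => le_max_of_le_left ?_⟩
  exact hC (t, s) ⟨ht, hs⟩

/-- A map into `ℓ_p` with continuous coordinates and uniformly small tails is continuous. -/
theorem lp_continuous_of_tail_lt {X : Type*} [TopologicalSpace X] {p : ℝ≥0∞} [Fact (1 ≤ p)]
    (hp : 0 < p.toReal) (φ : X → lp (fun _ : ℕ => ℝ) p) (hφ : ∀ j, Continuous fun x => φ x j)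
    (htail : ∀ ε > 0, ∀ᶠ n in atTop, ∀ x,
      ‖φ x‖ ^ p.toReal - ∑ j ∈ Finset.range n, ‖φ x j‖ ^ p.toReal < ε) :
    Continuous φ := by
  have hunif : TendstoUniformly
      (fun n x => ∑ j ∈ Finset.range n, lp.single (E := fun _ : ℕ => ℝ) p j (φ x j)) φ atTop := by
    rw [Metric.tendstoUniformly_iff]
    intro ε hε
    filter_upwards [htail (ε ^ p.toReal) (by positivity)] with n hn x
    rw [dist_eq_norm, ← Real.rpow_lt_rpow_iff (norm_nonneg _) hε.le hp,
      lp.norm_compl_sum_single hp]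
    exact hn x
  refine hunif.continuous (Frequently.of_forall fun n => ?_)
  exact continuous_finsetSum _ fun j _ => (lp.isometry_single j).continuous.comp (hφ j)

/-- If `|a_j|^p ≤ b_j + M |w_j|^p`, then the tails of `a` are controlled by those of `b` and `w`. -/
theorem lp_tail_le {p : ℝ≥0∞} (hp : 0 < p.toReal) (a w : lp (fun _ : ℕ => ℝ) p) {b : ℕ → ℝ}
    {M B : ℝ} (hb : HasSum b B)
    (h : ∀ j, ‖a j‖ ^ p.toReal ≤ b j + M * ‖w j‖ ^ p.toReal) (n : ℕ) :
    ‖a‖ ^ p.toReal - ∑ j ∈ Finset.range n, ‖a j‖ ^ p.toReal ≤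
      (B - ∑ j ∈ Finset.range n, b j) +
        M * (‖w‖ ^ p.toReal - ∑ j ∈ Finset.range n, ‖w j‖ ^ p.toReal) := by
  have hsum := (hb.add ((lp.hasSum_norm hp w).mul_left M)).sub (lp.hasSum_norm hp a)
  have hle := sum_le_hasSum (Finset.range n) (fun j _ => sub_nonneg.2 (h j)) hsum
  rw [Finset.sum_sub_distrib, Finset.sum_add_distrib, ← Finset.mul_sum] at hle
  linarith

/-- The integral operator with kernel `greenG T` on functions from `[0, T]` to `ℓ_p`. -/
noncomputable def greenIntegral {p : ℝ≥0∞} [Fact (1 ≤ p)] {T : ℝ} (hT : 0 ≤ T)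
    (φ : C(Icc (0 : ℝ) T, lp (fun _ : ℕ => ℝ) p)) (t : ℝ) : lp (fun _ : ℕ => ℝ) p :=
  ∫ s in (0 : ℝ)..T, greenG T t s • φ (projIcc 0 T hT s)

section greenIntegral

variable {p : ℝ≥0∞} [Fact (1 ≤ p)] {T : ℝ} (hT : 0 ≤ T)
  (φ ψ : C(Icc (0 : ℝ) T, lp (fun _ : ℕ => ℝ) p))

theorem continuous_greenIntegrand :
    Continuous fun x : ℝ × ℝ => greenG T x.1 x.2 • φ (projIcc 0 T hT x.2) :=
  (continuous_greenG T).smul (φ.continuous.comp (continuous_projIcc.comp continuous_snd))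

theorem intervalIntegrable_greenIntegrand (t : ℝ) :
    IntervalIntegrable (fun s => greenG T t s • φ (projIcc 0 T hT s)) volume 0 T :=
  ((continuous_greenIntegrand hT φ).comp (Continuous.prodMk_right t)).intervalIntegrable _ _

theorem continuous_greenIntegral : Continuous (greenIntegral hT φ) :=
  continuous_parametric_intervalIntegral_of_continuous' (continuous_greenIntegrand hT φ) 0 T

theorem greenIntegral_apply {a : ℝ → ℝ} {j : ℕ}
    (ha : ∀ s : Icc (0 : ℝ) T, φ s j = a s) (t : ℝ) :
    greenIntegral hT φ t j = ∫ s in (0 : ℝ)..T, greenG T t s * a s := by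
  have h := (lp.evalCLM ℝ (fun _ : ℕ => ℝ) p j).intervalIntegral_comp_comm
    (intervalIntegrable_greenIntegrand hT φ t)
  refine Eq.trans h.symm (intervalIntegral.integral_congr fun s hs => ?_)
  rw [uIcc_of_le hT] at hs
  change greenG T t s * φ (projIcc 0 T hT s) j = _
  rw [projIcc_of_mem hT hs, ha ⟨s, hs⟩]

theorem norm_greenIntegral_sub_le {C t : ℝ} (hC : ∀ s ∈ Icc 0 T, |greenG T t s| ≤ C) :
    ‖greenIntegral hT φ t - greenIntegral hT ψ t‖ ≤ C * ‖φ - ψ‖ * T := by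
  unfold greenIntegral
  rw [← intervalIntegral.integral_sub (intervalIntegrable_greenIntegrand hT φ t)
    (intervalIntegrable_greenIntegrand hT ψ t)]
  refine (intervalIntegral.norm_integral_le_of_norm_le_const (C := C * ‖φ - ψ‖)
    fun s hs => ?_).trans_eq (by rw [sub_zero, abs_of_nonneg hT])
  rw [uIoc_of_le hT] at hs
  rw [← smul_sub, norm_smul, Real.norm_eq_abs]
  have hG := hC s ⟨hs.1.le, hs.2⟩
  exact mul_le_mul hG ((φ - ψ).norm_coe_le_norm _) (norm_nonneg _) ((abs_nonneg _).trans hG)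

end greenIntegral

/-- The operator `ℱ`, `(ℱv)_j(t) = ∫₀ᵀ G(t,s)·f_j(s,v(s)) ds`, maps `C(I,ℓ_p)` into
`C(I,ℓ_p)` and is continuous with respect to the supremum norm. -/
theorem operator_maps_and_continuous
    (p : ℝ≥0∞) [Fact (1 ≤ p)] (hp : p ≠ ∞)
    (T : ℝ) (hT0 : 0 < T) (hTpi : T < Real.pi)
    (f : ℕ → ℝ → lp (fun _ : ℕ => ℝ) p → ℝ)
    -- (i)
    (hmem : ∀ t ∈ Set.Icc (0:ℝ) T, ∀ v : lp (fun _ : ℕ => ℝ) p,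
      Memℓp (fun j => f j t v) p)
    -- (ii)
    (hcont : ∀ v : ℝ → lp (fun _ : ℕ => ℝ) p, ContinuousOn v (Set.Icc (0:ℝ) T) →
      ∀ j : ℕ, ContinuousOn (fun t => f j t (v t)) (Set.Icc (0:ℝ) T))
    -- (iii)
    (hequi : ∀ v : lp (fun _ : ℕ => ℝ) p, ∀ ε > (0:ℝ), ∃ δ > (0:ℝ),
      ∀ u : lp (fun _ : ℕ => ℝ) p, ‖u - v‖ < δ → ∀ t ∈ Set.Icc (0:ℝ) T,
        (∑' j : ℕ, |f j t u - f j t v| ^ p.toReal) ^ (1 / p.toReal) < ε)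
    -- (iv)
    (g h : ℕ → ℝ → ℝ)
    (hgc : ∀ j, ContinuousOn (g j) (Set.Icc (0:ℝ) T))
    (hgnn : ∀ j, ∀ t ∈ Set.Icc (0:ℝ) T, 0 ≤ g j t)
    (hhc : ∀ j, ContinuousOn (h j) (Set.Icc (0:ℝ) T))
    (hhnn : ∀ j, ∀ t ∈ Set.Icc (0:ℝ) T, 0 ≤ h j t)
    (hgrowth : ∀ j, ∀ t ∈ Set.Icc (0:ℝ) T, ∀ v : lp (fun _ : ℕ => ℝ) p,
      |f j t v| ^ p.toReal ≤ g j t + h j t * |v j| ^ p.toReal)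
    (hgu : TendstoUniformlyOn (fun n t => ∑ j ∈ Finset.range n, g j t)
      (fun t => ∑' j : ℕ, g j t) Filter.atTop (Set.Icc (0:ℝ) T))
    (hhb : ∃ M : ℝ, ∀ j, ∀ t ∈ Set.Icc (0:ℝ) T, h j t ≤ M) :
    -- `ℱ` maps `C(I,ℓ_p)` into itself:
    (∀ v : ℝ → lp (fun _ : ℕ => ℝ) p, ContinuousOn v (Set.Icc (0:ℝ) T) →
      ∃ Fv : ℝ → lp (fun _ : ℕ => ℝ) p,
        (∀ t ∈ Set.Icc (0:ℝ) T, ∀ j : ℕ,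
          Fv t j = ∫ s in (0:ℝ)..T, greenG T t s * f j s (v s)) ∧
        ContinuousOn Fv (Set.Icc (0:ℝ) T)) ∧
    -- `ℱ` is continuous with respect to the supremum norm:
    (∀ v : ℝ → lp (fun _ : ℕ => ℝ) p, ContinuousOn v (Set.Icc (0:ℝ) T) →
      ∀ ε > (0:ℝ), ∃ δ > (0:ℝ),
        ∀ u : ℝ → lp (fun _ : ℕ => ℝ) p, ContinuousOn u (Set.Icc (0:ℝ) T) →
          (⨆ t : Set.Icc (0:ℝ) T, ‖u ↑t - v ↑t‖) < δ →
          ∀ t ∈ Set.Icc (0:ℝ) T,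
            (∑' j : ℕ, |(∫ s in (0:ℝ)..T, greenG T t s * f j s (u s)) -
              (∫ s in (0:ℝ)..T, greenG T t s * f j s (v s))| ^ p.toReal) ^ (1 / p.toReal)
              < ε) := by
  have hp0 : 0 < p.toReal :=
    ENNReal.toReal_pos (zero_lt_one.trans_le (Fact.out : 1 ≤ p)).ne' hp
  obtain ⟨M, hM⟩ := hhb
  have hgsum (t : Icc (0 : ℝ) T) : HasSum (fun j => g j t) (∑' j, g j t) :=
    (hasSum_iff_tendsto_nat_of_nonneg (fun j => hgnn j t t.2) _).2 (hgu.tendsto_at t.2)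
  let F (w : lp (fun _ : ℕ => ℝ) p) (t : Icc (0 : ℝ) T) : lp (fun _ : ℕ => ℝ) p :=
    ⟨fun j => f j t w, hmem t t.2 w⟩
  have hFcont (w : lp (fun _ : ℕ => ℝ) p) : Continuous (F w) := by
    refine lp_continuous_of_tail_lt hp0 _
      (fun j => (hcont (fun _ => w) continuousOn_const j).domRestrict) fun ε hε => ?_
    have hw : ∀ᶠ n in atTop,
        M * (‖w‖ ^ p.toReal - ∑ j ∈ Finset.range n, ‖w j‖ ^ p.toReal) < ε / 2 := by
      have h0 := ((lp.hasSum_norm hp0 w).tendsto_sum_nat.const_sub (‖w‖ ^ p.toReal)).const_mul M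
      rw [sub_self, mul_zero] at h0
      exact h0.eventually_lt_const (half_pos hε)
    filter_upwards [hw, Metric.tendstoUniformlyOn_iff.1 hgu (ε / 2) (half_pos hε)]
      with n hwn hgn t
    have htail := lp_tail_le hp0 (F w t) w (hgsum t) (M := M)
      (fun j => (hgrowth j t t.2 w).trans <| by
        rw [Real.norm_eq_abs]
        gcongr
        exact hM j t t.2) n
    have hg := (le_abs_self _).trans_lt (hgn t t.2)
    linarith
  let Φ (w : lp (fun _ : ℕ => ℝ) p) : C(Icc (0 : ℝ) T, lp (fun _ : ℕ => ℝ) p) :=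
    ⟨F w, hFcont w⟩
  have hΦ : Continuous Φ := by
    refine Metric.continuous_iff.2 fun w ε hε => ?_
    obtain ⟨δ, hδ, hwδ⟩ := hequi w ε hε
    refine ⟨δ, hδ, fun u hu => (ContinuousMap.dist_lt_iff hε).2 fun t => ?_⟩
    rw [dist_eq_norm] at hu ⊢
    rw [lp.norm_eq_tsum_rpow hp0]
    exact hwδ u hu t t.2
  let N (v : C(Icc (0 : ℝ) T, lp (fun _ : ℕ => ℝ) p)) :
      C(Icc (0 : ℝ) T, lp (fun _ : ℕ => ℝ) p) :=
    ⟨fun t => Φ (v t) t, by fun_prop⟩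
  refine ⟨fun v hv => ?_, fun v hv ε hε => ?_⟩
  · exact ⟨greenIntegral hT0.le (N ⟨_, hv.domRestrict⟩),
      fun t _ j => greenIntegral_apply _ _ (fun _ => rfl) t,
      (continuous_greenIntegral _ _).continuousOn⟩
  obtain ⟨C, hC0, hC⟩ := exists_abs_greenG_le T
  have hη : 0 < ε / (2 * (C * T)) := by positivity
  obtain ⟨δ, hδ, hvδ⟩ := Metric.mem_uniformity_dist.1
    ((isCompact_Icc.image_of_continuousOn hv).uniformContinuousAt_of_continuousAt Φ
      (fun _ _ => hΦ.continuousAt) (Metric.dist_mem_uniformity hη))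
  refine ⟨δ, hδ, fun u hu huv t ht => ?_⟩
  set u' : C(Icc (0 : ℝ) T, lp (fun _ : ℕ => ℝ) p) := ⟨_, hu.domRestrict⟩
  set v' : C(Icc (0 : ℝ) T, lp (fun _ : ℕ => ℝ) p) := ⟨_, hv.domRestrict⟩
  have hbdd : BddAbove (range fun s : Icc (0 : ℝ) T => ‖u s - v s‖) :=
    (isCompact_range (u' - v').continuous.norm).bddAbove
  have hN : ‖N u' - N v'‖ ≤ ε / (2 * (C * T)) := by
    refine (ContinuousMap.norm_le _ hη.le).2 fun s => ?_
    have hs : dist (v s) (u s) < δ := by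
      rw [dist_comm, dist_eq_norm]
      exact (le_ciSup hbdd s).trans_lt huv
    have hΦs := hvδ hs (mem_image_of_mem v s.2)
    have hdist := (ContinuousMap.dist_apply_le_dist (f := Φ (v s)) (g := Φ (u s)) s).trans hΦs.le
    rwa [dist_comm, dist_eq_norm] at hdist
  have hnorm := norm_greenIntegral_sub_le hT0.le (N u') (N v') (hC t ht)
  rw [lp.norm_eq_tsum_rpow hp0] at hnorm
  simp only [lp.coeFn_sub, Pi.sub_apply, Real.norm_eq_abs] at hnorm
  simp only [greenIntegral_apply hT0.le (N u') (a := fun s => f _ s (u s)) (fun _ => rfl),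
    greenIntegral_apply hT0.le (N v') (a := fun s => f _ s (v s)) (fun _ => rfl)] at hnorm
  refine hnorm.trans_lt ?_
  calc C * ‖N u' - N v'‖ * T ≤ C * (ε / (2 * (C * T))) * T := by gcongr
    _ = ε / 2 := by field_simp
    _ < ε := half_lt_self hε
end

section
/- For every r > 0, the family {ℱv : v ∈ C(I,ℓ_p), sup_{t∈I} ‖v(t)‖_p ≤ r} is uniformly equicontinuous on I: for every ε > 0 there exists δ > 0 such that for every v ∈ C(I,ℓ_p) with sup_{s∈I} ‖v(s)‖_p ≤ r and all t, t' ∈ I with |t − t'| < δ, one has ‖(ℱv)(t) − (ℱv)(t')‖_p < ε. -/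
open Real Set MeasureTheory intervalIntegral Filter
open scoped ENNReal Topology

lemma continuous_greenG_s9 (T t : ℝ) : Continuous (greenG T t) := by
  unfold greenG
  refine Continuous.if_le (by fun_prop) (by fun_prop) continuous_id continuous_const ?_
  rintro s rfl
  rfl

lemma abs_greenG_sub_le_of_le {T : ℝ} (hT : 0 < Real.sin T) (s : ℝ) {t t' : ℝ} (htt : t ≤ t') :
    |greenG T t s - greenG T t' s| ≤ |t - t'| / Real.sin T := by
  have sin_lip (a b : ℝ) : |Real.sin a - Real.sin b| ≤ |a - b| := by
    simpa [Real.dist_eq] using Real.lipschitzWith_sin.dist_le_mul a b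
  have left_branch (a b : ℝ) :
      |Real.sin a * Real.sin (T - s) / Real.sin T - Real.sin b * Real.sin (T - s) / Real.sin T|
        ≤ |a - b| / Real.sin T := by
    rw [← sub_div, ← sub_mul, abs_div, abs_mul, abs_of_pos hT]
    gcongr
    exact (mul_le_of_le_one_right (abs_nonneg _) (Real.abs_sin_le_one _)).trans (sin_lip a b)
  have right_branch (a b : ℝ) :
      |Real.sin s * Real.sin (T - a) / Real.sin T - Real.sin s * Real.sin (T - b) / Real.sin T|
        ≤ |a - b| / Real.sin T := by
    rw [← sub_div, ← mul_sub, abs_div, abs_mul, abs_of_pos hT]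
    gcongr
    refine (mul_le_of_le_one_left (abs_nonneg _) (Real.abs_sin_le_one _)).trans ?_
    have := sin_lip (T - a) (T - b)
    rwa [sub_sub_sub_cancel_left, abs_sub_comm b a] at this
  unfold greenG
  split_ifs with h₁ h₂ h₂
  · exact left_branch t t'
  · exact absurd (h₁.trans htt) h₂
  · -- here `t < s ≤ t'`: pass through the diagonal value at `s`
    push Not at h₁
    refine (abs_sub_le _ (Real.sin s * Real.sin (T - s) / Real.sin T) _).trans
      ((add_le_add (right_branch t s) (left_branch s t')).trans_eq ?_)
    rw [abs_of_nonpos (by linarith), abs_of_nonpos (by linarith), abs_of_nonpos (by linarith)]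
    ring
  · exact right_branch t t'

lemma abs_greenG_sub_le {T : ℝ} (hT : 0 < Real.sin T) (t t' s : ℝ) :
    |greenG T t s - greenG T t' s| ≤ |t - t'| / Real.sin T := by
  rcases le_total t t' with htt | htt
  · exact abs_greenG_sub_le_of_le hT s htt
  · rw [abs_sub_comm, abs_sub_comm t t']
    exact abs_greenG_sub_le_of_le hT s htt

/-- Minkowski's integral inequality for finitely many weighted coordinates, with a uniform bound on
the integrand. -/
lemma sum_abs_integral_mul_rpow_le {p : ℝ≥0∞} [Fact (1 ≤ p)] (hp : p ≠ ∞) {T : ℝ} (hT : 0 ≤ T)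
    {a : ℝ → ℝ} (ha : Continuous a) {φ : ℕ → ℝ → ℝ} (hφ : ∀ j, ContinuousOn (φ j) (Set.Icc 0 T))
    {A K : ℝ} (haA : ∀ s, |a s| ≤ A) (n : ℕ)
    (hφK : ∀ s ∈ Set.Icc 0 T, ∑ j ∈ Finset.range n, |φ j s| ^ p.toReal ≤ K) :
    ∑ j ∈ Finset.range n, |∫ s in (0:ℝ)..T, a s * φ j s| ^ p.toReal
      ≤ (A * K ^ (1 / p.toReal) * T) ^ p.toReal := by
  have hp0 : 0 < p.toReal :=
    ENNReal.toReal_pos (zero_lt_one.trans_le (Fact.out : 1 ≤ p)).ne' hp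
  let Φ : ℝ → PiLp p (fun _ : Fin n => ℝ) := fun s => WithLp.toLp p fun j => φ j s
  have hΦ : ContinuousOn (fun s => a s • Φ s) (Set.Icc 0 T) :=
    ha.continuousOn.smul ((PiLp.continuous_toLp p _).comp_continuousOn
      (continuousOn_pi.2 fun j => hφ j))
  have hint : IntervalIntegrable (fun s => a s • Φ s) volume 0 T :=
    ContinuousOn.intervalIntegrable (by rwa [Set.uIcc_of_le hT])
  have hcoord (j : Fin n) :
      (∫ s in (0:ℝ)..T, a s • Φ s) j = ∫ s in (0:ℝ)..T, a s * φ j s :=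
    ((PiLp.proj p (fun _ : Fin n => ℝ) j : PiLp p (fun _ : Fin n => ℝ) →L[ℝ] ℝ)
      |>.intervalIntegral_comp_comm hint).symm
  have hnorm : ‖∫ s in (0:ℝ)..T, a s • Φ s‖ ≤ A * K ^ (1 / p.toReal) * T := by
    have := intervalIntegral.norm_integral_le_of_norm_le_const (a := 0) (b := T)
      (f := fun s => a s • Φ s) (C := A * K ^ (1 / p.toReal)) fun s hs => by
        rw [Set.uIoc_of_le hT] at hs
        rw [norm_smul, PiLp.norm_eq_sum hp0]
        have hA : 0 ≤ A := (abs_nonneg _).trans (haA s)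
        gcongr
        · exact haA s
        · simpa [Φ, Finset.sum_range] using hφK s (Set.Ioc_subset_Icc_self hs)
    simpa [abs_of_nonneg hT] using this
  have hpow := Real.rpow_le_rpow (norm_nonneg _) hnorm hp0.le
  rw [PiLp.norm_eq_sum hp0, one_div, Real.rpow_inv_rpow (by positivity) hp0.ne'] at hpow
  simpa [hcoord, Finset.sum_range] using hpow

/-- The partial sums of a uniformly convergent series of nonnegative continuous functions on a
compact set are uniformly bounded. -/
lemma exists_sum_le_of_tendstoUniformlyOn {X : Type*} [TopologicalSpace X] {S : Set X}
    (hS : IsCompact S) {g : ℕ → X → ℝ} (hgc : ∀ j, ContinuousOn (g j) S)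
    (hgnn : ∀ j, ∀ t ∈ S, 0 ≤ g j t)
    (hgu : TendstoUniformlyOn (fun n t => ∑ j ∈ Finset.range n, g j t)
      (fun t => ∑' j : ℕ, g j t) atTop S) :
    ∃ B : ℝ, 0 ≤ B ∧ ∀ n, ∀ t ∈ S, ∑ j ∈ Finset.range n, g j t ≤ B := by
  have hlim : ContinuousOn (fun t => ∑' j : ℕ, g j t) S :=
    hgu.continuousOn (Frequently.of_forall fun n => continuousOn_finsetSum _ fun j _ => hgc j)
  obtain ⟨B, hB⟩ := hS.bddAbove_image hlim
  refine ⟨max B 0, le_max_right _ _, fun n t ht => ?_⟩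
  have hsum : Summable fun j => g j t :=
    ((hasSum_iff_tendsto_nat_of_nonneg (fun j => hgnn j t ht) _).2
      (hgu.tendsto_at ht)).summable
  exact (hsum.sum_le_tsum _ fun j _ => hgnn j t ht).trans
    ((hB (Set.mem_image_of_mem _ ht)).trans (le_max_left _ _))

/-- For every `r > 0`, the family `{ℱv : v ∈ C(I,ℓ_p), ‖v‖ ≤ r}` is uniformly
equicontinuous on `I`. -/
theorem operator_image_equicontinuous
    (p : ℝ≥0∞) [Fact (1 ≤ p)] (hp : p ≠ ∞)
    (T : ℝ) (hT0 : 0 < T) (hTpi : T < Real.pi)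
    (f : ℕ → ℝ → lp (fun _ : ℕ => ℝ) p → ℝ)
    -- (i)
    (hmem : ∀ t ∈ Set.Icc (0:ℝ) T, ∀ v : lp (fun _ : ℕ => ℝ) p,
      Memℓp (fun j => f j t v) p)
    -- (ii)
    (hcont : ∀ v : ℝ → lp (fun _ : ℕ => ℝ) p, ContinuousOn v (Set.Icc (0:ℝ) T) →
      ∀ j : ℕ, ContinuousOn (fun t => f j t (v t)) (Set.Icc (0:ℝ) T))
    -- (iv)
    (g h : ℕ → ℝ → ℝ)
    (hgc : ∀ j, ContinuousOn (g j) (Set.Icc (0:ℝ) T))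
    (hgnn : ∀ j, ∀ t ∈ Set.Icc (0:ℝ) T, 0 ≤ g j t)
    (hhc : ∀ j, ContinuousOn (h j) (Set.Icc (0:ℝ) T))
    (hhnn : ∀ j, ∀ t ∈ Set.Icc (0:ℝ) T, 0 ≤ h j t)
    (hgrowth : ∀ j, ∀ t ∈ Set.Icc (0:ℝ) T, ∀ v : lp (fun _ : ℕ => ℝ) p,
      |f j t v| ^ p.toReal ≤ g j t + h j t * |v j| ^ p.toReal)
    (hgu : TendstoUniformlyOn (fun n t => ∑ j ∈ Finset.range n, g j t)
      (fun t => ∑' j : ℕ, g j t) Filter.atTop (Set.Icc (0:ℝ) T))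
    (hhb : ∃ M : ℝ, ∀ j, ∀ t ∈ Set.Icc (0:ℝ) T, h j t ≤ M) :
    ∀ r > (0:ℝ), ∀ ε > (0:ℝ), ∃ δ > (0:ℝ),
      ∀ v : ℝ → lp (fun _ : ℕ => ℝ) p, ContinuousOn v (Set.Icc (0:ℝ) T) →
        (∀ s ∈ Set.Icc (0:ℝ) T, ‖v s‖ ≤ r) →
        ∀ t ∈ Set.Icc (0:ℝ) T, ∀ t' ∈ Set.Icc (0:ℝ) T, |t - t'| < δ →
          (∑' j : ℕ, |(∫ s in (0:ℝ)..T, greenG T t s * f j s (v s)) -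
            (∫ s in (0:ℝ)..T, greenG T t' s * f j s (v s))| ^ p.toReal) ^ (1 / p.toReal)
            < ε := by
  intro r hr ε hε
  have hp0 : 0 < p.toReal :=
    ENNReal.toReal_pos (zero_lt_one.trans_le (Fact.out : 1 ≤ p)).ne' hp
  have hsin : 0 < Real.sin T := Real.sin_pos_of_pos_of_lt_pi hT0 hTpi
  obtain ⟨B, hB0, hB⟩ := exists_sum_le_of_tendstoUniformlyOn isCompact_Icc hgc hgnn hgu
  obtain ⟨M, hM⟩ := hhb
  have h0 : (0:ℝ) ∈ Set.Icc 0 T := ⟨le_rfl, hT0.le⟩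
  have hM0 : 0 ≤ M := (hhnn 0 0 h0).trans (hM 0 0 h0)
  let K := B + M * r ^ p.toReal
  have hK0 : 0 ≤ K := by positivity
  let C := K ^ (1 / p.toReal) * T / Real.sin T
  have hC0 : 0 ≤ C := by positivity
  refine ⟨ε / (C + 1), by positivity, fun v hv hvr t ht t' ht' htt => ?_⟩
  have hfK (n : ℕ) : ∀ s ∈ Set.Icc 0 T,
      ∑ j ∈ Finset.range n, |f j s (v s)| ^ p.toReal ≤ K := fun s hs => by
    have hvs : ∑ j ∈ Finset.range n, |v s j| ^ p.toReal ≤ r ^ p.toReal :=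
      (lp.sum_rpow_le_norm_rpow hp0 (v s) (Finset.range n)).trans
        (Real.rpow_le_rpow (norm_nonneg _) (hvr s hs) hp0.le)
    calc ∑ j ∈ Finset.range n, |f j s (v s)| ^ p.toReal
        ≤ ∑ j ∈ Finset.range n, (g j s + M * |v s j| ^ p.toReal) := by
          refine Finset.sum_le_sum fun j _ => (hgrowth j s hs (v s)).trans ?_
          gcongr
          exact hM j s hs
      _ = ∑ j ∈ Finset.range n, g j s + M * ∑ j ∈ Finset.range n, |v s j| ^ p.toReal := by
          rw [Finset.sum_add_distrib, Finset.mul_sum]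
      _ ≤ K := add_le_add (hB n s hs) (mul_le_mul_of_nonneg_left hvs hM0)
  have hint (τ : ℝ) (j : ℕ) :
      IntervalIntegrable (fun s => greenG T τ s * f j s (v s)) volume 0 T := by
    apply ContinuousOn.intervalIntegrable
    rw [Set.uIcc_of_le hT0.le]
    exact (continuous_greenG_s9 T τ).continuousOn.mul (hcont v hv j)
  have hbound : ∑' j : ℕ, |(∫ s in (0:ℝ)..T, greenG T t s * f j s (v s)) -
      (∫ s in (0:ℝ)..T, greenG T t' s * f j s (v s))| ^ p.toReal
      ≤ (|t - t'| * C) ^ p.toReal := by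
    refine Real.tsum_le_of_sum_range_le (fun j => by positivity) fun n => ?_
    have := sum_abs_integral_mul_rpow_le hp hT0.le
      ((continuous_greenG_s9 T t).sub (continuous_greenG_s9 T t')) (hcont v hv)
      (fun s => abs_greenG_sub_le hsin t t' s) n (hfK n)
    convert this using 1
    · refine Finset.sum_congr rfl fun j _ => ?_
      rw [← intervalIntegral.integral_sub (hint t j) (hint t' j)]
      simp only [Pi.sub_apply, sub_mul]
    · congr 1
      simp only [C]
      ring
  calc _ ≤ ((|t - t'| * C) ^ p.toReal) ^ (1 / p.toReal) := by
        refine Real.rpow_le_rpow (tsum_nonneg fun j => by positivity) hbound (by positivity)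
    _ = |t - t'| * C := by rw [one_div, Real.rpow_rpow_inv (by positivity) hp0.ne']
    _ ≤ |t - t'| * (C + 1) := by gcongr; linarith
    _ < ε := (lt_div_iff₀ (by positivity)).1 htt
end

section
/- (Darbo's fixed point theorem.) Let X be a real Banach space and for a bounded set A ⊆ X let χ(A) denote its Hausdorff measure of noncompactness, χ(A) = inf{ε > 0 : A can be covered by finitely many open balls of X of radii < ε}. Let E be a nonempty, bounded, closed and convex subset of X and let T : E → E be a continuous mapping such that there exists a constant k ∈ [0,1) with χ(T(A)) ≤ k·χ(A) for every nonempty subset A of E. Then T has a fixed point in E. -/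
open Set Metric

/-- The Hausdorff measure of noncompactness of a subset `A` of a normed space:
the infimum of all `ε > 0` such that `A` can be covered by finitely many open balls
of radii `< ε`. -/
noncomputable def hausdorffMNC {X : Type*} [NormedAddCommGroup X] (A : Set X) : ℝ :=
  sInf {ε : ℝ | 0 < ε ∧ ∃ (n : ℕ) (c : Fin n → X) (ρ : Fin n → ℝ),
    (∀ i, ρ i < ε) ∧ A ⊆ ⋃ i, Metric.ball (c i) (ρ i)}

section Retraction

open MeasureTheory Module

variable {E : Type*} [NormedAddCommGroup E] [InnerProductSpace ℝ E] [FiniteDimensional ℝ E]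

/-- `det (1 + A)` is obtained by Lagrange interpolation from the values of the polynomial
`a ↦ det (1 + a • A)` at more than `dim E` nodes. -/
lemma det_one_add_eq_sum_lagrange (A : E →L[ℝ] E) (s : Finset ℝ) (hs : finrank ℝ E < s.card) :
    (1 + A).det = ∑ a ∈ s, (Lagrange.basis s id a).eval 1 * (1 + a • A).det := by
  let b := finBasis ℝ E
  let M := LinearMap.toMatrix b b (A : E →ₗ[ℝ] E)
  let p : Polynomial ℝ :=
    ((Polynomial.X : Polynomial ℝ) • M.map Polynomial.C +
      (1 : Matrix (Fin (finrank ℝ E)) (Fin (finrank ℝ E)) ℝ).map Polynomial.C).det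
  have heval : ∀ a : ℝ, p.eval a = (1 + a • A).det := by
    intro a
    have h : (1 + a • A).det = (1 + a • M).det := by
      rw [ContinuousLinearMap.det, ← LinearMap.det_toMatrix b]
      congr 1
      simp only [ContinuousLinearMap.toLinearMap_add, map_add,
        ContinuousLinearMap.toLinearMap_smul, map_smul]
      congr 1
      exact LinearMap.toMatrix_one b
    rw [h]
    simp only [p]
    rw [← Polynomial.coe_evalRingHom, RingHom.map_det, add_comm]
    congr 1
    ext i j
    simp [Matrix.one_apply, apply_ite]
    exact mul_comm _ _
  have hdeg : p.degree < s.card := by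
    refine Polynomial.degree_le_natDegree.trans_lt ?_
    have := Polynomial.natDegree_det_X_add_C_le M 1
    rw [Fintype.card_fin] at this
    exact_mod_cast this.trans_lt hs
  have h1 := congrArg (Polynomial.eval 1) (Lagrange.eq_interpolate (v := id) (injOn_id _) hdeg)
  rw [heval, one_smul, Lagrange.interpolate_apply, Polynomial.eval_finsetSum] at h1
  rw [h1]
  refine Finset.sum_congr rfl fun a _ => ?_
  rw [Polynomial.eval_mul, Polynomial.eval_C, id, heval, mul_comm]

lemma det_one_add_pos {A : E →L[ℝ] E} (hA : ‖A‖ < 1) : 0 < (1 + A).det := by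
  have hne : ∀ a ∈ Icc (0 : ℝ) 1, (1 + a • A).det ≠ 0 := by
    intro a ha h0
    obtain ⟨v, hv, hv0⟩ := Submodule.exists_mem_ne_zero_of_ne_bot
      (LinearMap.det_eq_zero_iff_ker_ne_bot.1 h0)
    have hv' : v = -(a • A v) := by
      have : v + a • A v = 0 := by simpa using hv
      exact eq_neg_of_add_eq_zero_left this
    have hpos : 0 < ‖v‖ := norm_pos_iff.2 hv0
    have : ‖v‖ < ‖v‖ := calc
      ‖v‖ = a * ‖A v‖ := by
        conv_lhs => rw [hv', norm_neg, norm_smul, Real.norm_of_nonneg ha.1]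
      _ ≤ 1 * (‖A‖ * ‖v‖) := by
        gcongr
        · exact ha.2
        · exact A.le_opNorm v
      _ < ‖v‖ := by nlinarith
    exact this.false
  by_contra hle
  have hc : ContinuousOn (fun a : ℝ => (1 + a • A).det) (Icc 0 1) :=
    (ContinuousLinearMap.continuous_det.comp
      (by fun_prop : Continuous fun a : ℝ => 1 + a • A)).continuousOn
  have h0 : (1 + (0 : ℝ) • A).det = 1 := by
    rw [zero_smul, add_zero]
    exact LinearMap.det_id
  obtain ⟨a, ha, ha0⟩ := intermediate_value_Icc' zero_le_one hc
    (show (0 : ℝ) ∈ Icc _ _ from ⟨by simpa using not_lt.1 hle, h0 ▸ zero_le_one⟩)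
  exact hne a ha ha0

lemma bijective_add_smul {g : E → E} {K : NNReal} (hg : LipschitzWith K g) {a : ℝ} (ha : 0 ≤ a)
    (haK : a * K < 1) : Function.Bijective fun x => x + a • g x := by
  constructor
  · intro x y hxy
    have h : x - y = a • (g y - g x) := by
      have : x + a • g x = y + a • g y := hxy
      rw [smul_sub, sub_eq_sub_iff_add_eq_add, this]
      abel
    have hd : dist x y ≤ a * K * dist x y := by
      calc dist x y = a * dist (g y) (g x) := by
            rw [dist_eq_norm, h, norm_smul, Real.norm_of_nonneg ha, dist_eq_norm]
        _ ≤ a * (K * dist y x) := by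
            gcongr
            exact hg.dist_le_mul y x
        _ = a * K * dist x y := by rw [dist_comm y x, mul_assoc]
    have := dist_nonneg (x := x) (y := y)
    exact dist_le_zero.1 (by nlinarith)
  · intro y
    have hc : ContractingWith (a.toNNReal * K) fun x => y - a • g x := by
      refine ⟨?_, LipschitzWith.of_dist_le_mul fun u v => ?_⟩
      · rw [← NNReal.coe_lt_coe]
        simpa [Real.coe_toNNReal a ha] using haK
      · rw [dist_sub_left, dist_smul₀, Real.norm_of_nonneg ha, NNReal.coe_mul,
          Real.coe_toNNReal a ha, mul_assoc]
        gcongr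
        exact hg.dist_le_mul u v
    obtain ⟨x, hx, -⟩ := hc.exists_fixedPoint y (edist_ne_top _ _)
    refine ⟨x, ?_⟩
    have hx : y - a • g x = x := hx
    simp only
    nth_rw 1 [← hx]
    simp

lemma image_ball_add_smul {g : E → E} {K : NNReal} (hg : LipschitzWith K g) {r : ℝ}
    (hout : ∀ x, r ≤ ‖x‖ → g x = 0) (hin : ∀ x, ‖x‖ < r → ‖x + g x‖ = r)
    {a : ℝ} (ha : 0 ≤ a) (ha1 : a < 1) (haK : a * K < 1) :
    (fun x => x + a • g x) '' ball 0 r = ball 0 r := by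
  refine Subset.antisymm ?_ fun y hy => ?_
  · rintro _ ⟨x, hx, rfl⟩
    rw [mem_ball_zero_iff] at hx ⊢
    calc ‖x + a • g x‖ = ‖(1 - a) • x + a • (x + g x)‖ := by
          congr 1; module
      _ ≤ (1 - a) * ‖x‖ + a * ‖x + g x‖ := by
          refine (norm_add_le _ _).trans_eq ?_
          rw [norm_smul, norm_smul, Real.norm_of_nonneg ha, Real.norm_of_nonneg (by linarith)]
      _ < r := by rw [hin x hx]; nlinarith
  · obtain ⟨x, hx⟩ := (bijective_add_smul hg ha haK).2 y
    refine ⟨x, ?_, hx⟩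
    by_contra hxr
    have h0 := hout x (by simpa using hxr)
    simp only [h0, smul_zero, add_zero] at hx
    exact hxr (hx ▸ hy)

lemma integral_det_one_add_smul_fderiv [MeasurableSpace E] [BorelSpace E] {g : E → E}
    {K : NNReal} (hg : LipschitzWith K g) {r : ℝ}
    (hout : ∀ x, r ≤ ‖x‖ → g x = 0) (hin : ∀ x, ‖x‖ < r → ‖x + g x‖ = r)
    {a : ℝ} (ha : 0 ≤ a) (ha1 : a < 1) (haK : a * K < 1) :
    IntegrableOn (fun x => (1 + a • fderiv ℝ g x).det) (ball 0 r)
      (Measure.hausdorffMeasure (finrank ℝ E)) ∧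
    ∫ x in ball 0 r, (1 + a • fderiv ℝ g x).det ∂(Measure.hausdorffMeasure (finrank ℝ E)) =
      (Measure.hausdorffMeasure (finrank ℝ E)).real (ball (0 : E) r) := by
  set μ : Measure E := Measure.hausdorffMeasure (finrank ℝ E) with hμ
  have : μ.IsAddHaarMeasure := isAddHaarMeasure_hausdorffMeasure
  let h : E → E := fun x => x + a • g x
  have hlip : LipschitzWith (1 + ‖a‖₊ * K) h :=
    LipschitzWith.id.add ((lipschitzWith_smul a).comp hg)
  let D : Set E := ball 0 r ∩ {x | DifferentiableAt ℝ g x}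
  have hD : MeasurableSet D := measurableSet_ball.inter (measurableSet_of_differentiableAt ℝ g)
  have hnull : μ (ball 0 r \ D) = 0 := by
    refine measure_mono_null ?_ (hg.ae_differentiableAt (μ := μ))
    intro x hx hdiff
    exact hx.2 ⟨hx.1, hdiff⟩
  have hDae : (D : Set E) =ᵐ[μ] ball 0 r :=
    Filter.EventuallyLE.antisymm inter_subset_left.eventuallyLE (ae_le_set.2 hnull)
  have himage : μ (h '' D) = μ (ball 0 r) := by
    have hsplit : ball 0 r ⊆ h '' D ∪ h '' (ball 0 r \ D) := by
      rw [← image_union, union_sdiff_cancel inter_subset_left]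
      exact (image_ball_add_smul hg hout hin ha ha1 haK).ge
    have hnull' : μ (h '' (ball 0 r \ D)) = 0 := by
      have := hlip.hausdorffMeasure_image_le (Nat.cast_nonneg (finrank ℝ E)) (ball 0 r \ D)
      rw [← hμ, hnull, mul_zero] at this
      exact le_antisymm this bot_le
    apply le_antisymm
    · exact measure_mono ((image_mono inter_subset_left).trans
        (image_ball_add_smul hg hout hin ha ha1 haK).le)
    · exact (measure_mono hsplit).trans ((measure_union_le _ _).trans (by simp [hnull']))
  have hderiv : ∀ x ∈ D, HasFDerivWithinAt h (1 + a • fderiv ℝ g x) D x := fun x hx =>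
    ((hasFDerivAt_id x).add (hx.2.hasFDerivAt.const_smul a)).hasFDerivWithinAt
  have hpos : ∀ x, 0 < (1 + a • fderiv ℝ g x).det := by
    intro x
    refine det_one_add_pos ?_
    rw [norm_smul, Real.norm_of_nonneg ha]
    exact (mul_le_mul_of_nonneg_left (norm_fderiv_le_of_lipschitz ℝ hg) ha).trans_lt haK
  have hlint : ∫⁻ x in ball 0 r, ENNReal.ofReal (1 + a • fderiv ℝ g x).det ∂μ
      = μ (ball 0 r) := by
    rw [← setLIntegral_congr hDae, ← himage,
      ← lintegral_abs_det_fderiv_eq_addHaar_image μ hD hderiv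
        (bijective_add_smul hg ha haK).1.injOn]
    simp only [abs_of_pos (hpos _)]
  have hmeas : Measurable fun x => (1 + a • fderiv ℝ g x).det :=
    ContinuousLinearMap.continuous_det.measurable.comp
      (((measurable_fderiv ℝ g).const_smul a).const_add 1)
  constructor
  · refine (lintegral_ofReal_ne_top_iff_integrable hmeas.aestronglyMeasurable
      (ae_of_all _ fun x => (hpos x).le)).1 ?_
    rw [hlint]
    exact measure_ball_lt_top.ne
  · rw [integral_eq_lintegral_of_nonneg_ae (ae_of_all _ fun x => (hpos x).le)
      hmeas.aestronglyMeasurable, hlint, measureReal_def]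

lemma det_eq_zero_of_norm_eq_const {F : E → E} {F' : E →L[ℝ] E} {x : E} {r : ℝ} (hr : 0 < r)
    (hF : HasFDerivAt F F' x) (hnorm : ∀ᶠ y in nhds x, ‖F y‖ = r) : F'.det = 0 := by
  by_contra hdet
  obtain ⟨v, hv⟩ := (LinearMap.equivOfDetNeZero (F' : E →ₗ[ℝ] E) hdet).surjective (F x)
  have hv : F' v = F x := hv
  have hconst : HasFDerivAt (fun y => ‖F y‖ ^ 2) (0 : E →L[ℝ] ℝ) x :=
    (hasFDerivAt_const (r ^ 2) x).congr_of_eventuallyEq (hnorm.mono fun y hy => by simp [hy])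
  have hzero := congrArg (fun L : E →L[ℝ] ℝ => L v) (hF.norm_sq.unique hconst)
  have hx : ‖F x‖ = r := hnorm.self_of_nhds
  simp [hv, hx] at hzero
  exact hr.ne' hzero

/-- There is no Lipschitz retraction of a ball onto its boundary sphere; the retraction is
`x ↦ x + g x`, continued by the identity outside the ball. -/
theorem not_exists_lipschitz_retraction {r : ℝ} (hr : 0 < r) {g : E → E} {K : NNReal}
    (hg : LipschitzWith K g) (hout : ∀ x, r ≤ ‖x‖ → g x = 0)
    (hin : ∀ x, ‖x‖ < r → ‖x + g x‖ = r) : False := by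
  borelize E
  set μ : Measure E := Measure.hausdorffMeasure (finrank ℝ E) with hμ
  have : μ.IsAddHaarMeasure := isAddHaarMeasure_hausdorffMeasure
  have hK : (0 : ℝ) < 1 / (K + 1) := by positivity
  obtain ⟨s, hs, hcard⟩ := (Ioo_infinite hK).exists_subset_card_eq (finrank ℝ E + 1)
  have hnode : ∀ a ∈ s, 0 ≤ a ∧ a < 1 ∧ a * K < 1 := by
    intro a ha
    obtain ⟨h0, h1⟩ := hs ha
    rw [lt_div_iff₀ (by positivity)] at h1
    have := mul_nonneg h0.le K.coe_nonneg
    refine ⟨h0.le, ?_, ?_⟩ <;> nlinarith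
  have hzero : ∫ x in ball 0 r, (1 + fderiv ℝ g x).det ∂μ = 0 := by
    refine integral_eq_zero_of_ae ?_
    filter_upwards [ae_restrict_of_ae (hg.ae_differentiableAt (μ := μ)),
      ae_restrict_mem measurableSet_ball] with x hx hxr
    refine det_eq_zero_of_norm_eq_const hr ((hasFDerivAt_id x).add hx.hasFDerivAt) ?_
    filter_upwards [isOpen_ball.mem_nhds hxr] with y hy
    exact hin y (by simpa using hy)
  have hsum : ∫ x in ball 0 r, (1 + fderiv ℝ g x).det ∂μ = μ.real (ball 0 r) := by
    simp_rw [fun x => det_one_add_eq_sum_lagrange (fderiv ℝ g x) s (by omega)]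
    rw [integral_finsetSum]
    · have hval : ∀ a ∈ s, ∫ x in ball 0 r, (Lagrange.basis s id a).eval 1 *
          (1 + a • fderiv ℝ g x).det ∂μ = (Lagrange.basis s id a).eval 1 * μ.real (ball 0 r) := by
        intro a ha
        obtain ⟨h0, h1, h2⟩ := hnode a ha
        rw [integral_const_mul,
          (integral_det_one_add_smul_fderiv hg hout hin h0 h1 h2).2]
      rw [Finset.sum_congr rfl hval, ← Finset.sum_mul, ← Polynomial.eval_finsetSum,
        Lagrange.sum_basis (injOn_id _) (Finset.card_pos.1 (by omega)), Polynomial.eval_one,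
        one_mul]
    · intro a ha
      obtain ⟨h0, h1, h2⟩ := hnode a ha
      exact (integral_det_one_add_smul_fderiv hg hout hin h0 h1 h2).1.const_mul _
  have hpos : 0 < μ.real (ball (0 : E) r) :=
    ENNReal.toReal_pos (measure_ball_pos μ 0 hr).ne' measure_ball_lt_top.ne
  linarith

end Retraction

lemma LipschitzWith.exists_inv_smul {α V : Type*} [PseudoMetricSpace α] [NormedAddCommGroup V]
    [NormedSpace ℝ V] {f : α → V} {s : α → ℝ} {Kf Ks : NNReal} (hf : LipschitzWith Kf f)
    (hs : LipschitzWith Ks s) {c : ℝ} (hc : 0 < c) (hcs : ∀ x, c ≤ s x)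
    (hfs : ∀ x, ‖f x‖ ≤ s x) : ∃ K, LipschitzWith K fun x => (s x)⁻¹ • f x := by
  refine ⟨_, LipschitzWith.of_dist_le' (K := (Kf + Ks) / c) fun x y => ?_⟩
  have hx : 0 < s x := hc.trans_le (hcs x)
  have hy : 0 < s y := hc.trans_le (hcs y)
  have hf' := hf.dist_le_mul x y
  have hs' := hs.dist_le_mul x y
  rw [dist_eq_norm] at hf'
  rw [Real.dist_eq] at hs'
  have hsplit : (s x)⁻¹ • f x - (s y)⁻¹ • f y
      = (s x)⁻¹ • ((f x - f y) - ((s x - s y) * (s y)⁻¹) • f y) := by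
    rw [smul_sub, smul_sub, smul_smul, sub_sub, ← add_smul]
    congr 2
    field_simp
    ring
  have hq : ‖((s x - s y) * (s y)⁻¹) • f y‖ ≤ |s x - s y| := by
    rw [norm_smul, norm_mul, norm_inv, Real.norm_eq_abs, Real.norm_of_nonneg hy.le, mul_assoc]
    refine mul_le_of_le_one_right (abs_nonneg _) ?_
    rw [inv_mul_le_iff₀ hy, mul_one]
    exact hfs y
  rw [dist_eq_norm, hsplit, norm_smul, norm_inv, Real.norm_of_nonneg hx.le]
  calc (s x)⁻¹ * ‖(f x - f y) - ((s x - s y) * (s y)⁻¹) • f y‖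
      ≤ c⁻¹ * (Kf * dist x y + Ks * dist x y) := by
        gcongr
        · exact hcs x
        · exact (_root_.norm_sub_le _ _).trans (add_le_add hf' (hq.trans hs'))
    _ = (Kf + Ks) / c * dist x y := by ring

/-- Brouwer's fixed point theorem for Lipschitz maps. -/
theorem LipschitzWith.exists_fixedPoint_of_norm_le_one {E : Type*} [NormedAddCommGroup E]
    [InnerProductSpace ℝ E] [FiniteDimensional ℝ E] {T : E → E} {K : NNReal}
    (hT : LipschitzWith K T) (hT1 : ∀ x, ‖T x‖ ≤ 1) : ∃ x, T x = x := by
  by_contra! hfix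
  -- `G` agrees with `x - T x` on the unit ball and with `x` outside the ball of radius `2`
  let c : E → ℝ := fun x => max (min (2 - ‖x‖) 1) 0
  let G : E → E := fun x => x - c x • T x
  have hc : LipschitzWith 1 c := by
    have h2 : LipschitzWith 1 fun x : E => 2 - ‖x‖ := by
      simpa using (LipschitzWith.const (2 : ℝ)).sub (lipschitzWith_one_norm (E := E))
    exact (h2.min_const 1).max_const 0
  have hc0 : ∀ x, 0 ≤ c x := fun x => le_max_right _ _
  have hc1 : ∀ x, c x ≤ 1 := fun x => max_le (min_le_right _ _) zero_le_one
  have hcT : LipschitzWith (K + 1) fun x => c x • T x := by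
    refine LipschitzWith.of_dist_le_mul fun x y => ?_
    have hsplit : c x • T x - c y • T y = c x • (T x - T y) + (c x - c y) • T y := by module
    have h1 := hT.dist_le_mul x y
    have h2 := hc.dist_le_mul x y
    rw [dist_eq_norm] at h1
    rw [Real.dist_eq] at h2
    rw [dist_eq_norm, hsplit]
    refine (norm_add_le _ _).trans ?_
    rw [norm_smul, norm_smul, Real.norm_of_nonneg (hc0 x), Real.norm_eq_abs,
      NNReal.coe_add, add_mul]
    exact add_le_add ((mul_le_of_le_one_left (norm_nonneg _) (hc1 x)).trans h1)
      ((mul_le_of_le_one_right (abs_nonneg _) (hT1 y)).trans h2)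
  have hG : LipschitzWith (1 + (K + 1)) G := LipschitzWith.id.sub hcT
  have hGout : ∀ x, 2 ≤ ‖x‖ → G x = x := by
    intro x hx
    have : c x = 0 := max_eq_right ((min_le_left _ _).trans (by linarith))
    simp [G, this]
  have hG0 : ∀ x, G x ≠ 0 := by
    intro x h0
    have hx : x = c x • T x := sub_eq_zero.1 h0
    rcases le_or_gt ‖x‖ 1 with h | h
    · have : c x = 1 := by
        simp only [c]
        rw [min_eq_right (by linarith), max_eq_left zero_le_one]
      rw [this, one_smul] at hx
      exact hfix x hx.symm
    · have hcx : c x < 1 := max_lt ((min_le_left _ _).trans_lt (by linarith)) zero_lt_one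
      have : ‖x‖ ≤ c x := by
        conv_lhs => rw [hx, norm_smul, Real.norm_of_nonneg (hc0 x)]
        exact mul_le_of_le_one_right (hc0 x) (hT1 x)
      linarith
  obtain ⟨δ, hδ, hGδ⟩ : ∃ δ, 0 < δ ∧ ∀ x, δ ≤ ‖G x‖ := by
    obtain ⟨z, -, hz⟩ := (isCompact_closedBall (0 : E) 2).exists_isMinOn
      ⟨0, by simp⟩ hG.continuous.norm.continuousOn
    refine ⟨min ‖G z‖ 2, lt_min (norm_pos_iff.2 (hG0 z)) two_pos, fun x => ?_⟩
    rcases le_total ‖x‖ 2 with h | h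
    · exact (min_le_left _ _).trans (hz (by simpa using h))
    · rw [hGout x h]
      exact (min_le_right _ _).trans h
  obtain ⟨K₁, hK₁⟩ := hG.exists_inv_smul (lipschitzWith_one_norm.comp hG) hδ hGδ fun _ => le_rfl
  obtain ⟨K₂, hK₂⟩ := (LipschitzWith.id (α := E)).exists_inv_smul
    (lipschitzWith_one_norm.max_const 2) two_pos (fun _ => le_max_right _ _)
    fun _ => le_max_left _ _
  refine not_exists_lipschitz_retraction two_pos ((lipschitzWith_smul (2 : ℝ)).comp (hK₁.sub hK₂))
    (fun x hx => ?_) fun x hx => ?_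
  · simp [hGout x hx, max_eq_left hx]
  · have h2 : max ‖x‖ 2 = 2 := max_eq_right hx.le
    have hpos : 0 < ‖G x‖ := norm_pos_iff.2 (hG0 x)
    simp [h2, smul_sub, norm_smul, hpos.ne']

section Simplex

variable {ι : Type*} [Fintype ι]

lemma exists_lipschitzWith_toLp {α : Type*} [PseudoMetricSpace α] {K : NNReal}
    {f : α → ι → ℝ} (hf : ∀ i, LipschitzWith K fun x => f x i) :
    ∃ K', LipschitzWith K' fun x => WithLp.toLp 2 (f x) := by
  have hpi : LipschitzWith K f := LipschitzWith.of_dist_le_mul fun x y =>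
    (dist_pi_le_iff (by positivity)).2 fun i => (hf i).dist_le_mul x y
  exact ⟨_, (PiLp.lipschitzWith_toLp 2 fun _ : ι => ℝ).comp hpi⟩

lemma lipschitzWith_finset_sum {α : Type*} [PseudoMetricSpace α] {K : NNReal} {f : ι → α → ℝ}
    (hf : ∀ i, LipschitzWith K (f i)) :
    LipschitzWith (Fintype.card ι * K) fun x => ∑ i, f i x := by
  refine LipschitzWith.of_dist_le_mul fun x y => ?_
  refine (dist_sum_sum_le_of_le _ fun i _ => (hf i).dist_le_mul x y).trans_eq ?_
  simp [mul_assoc]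

lemma norm_toLp_le_sum {v : ι → ℝ} (hv : ∀ i, 0 ≤ v i) : ‖WithLp.toLp 2 v‖ ≤ ∑ i, v i := by
  refine le_of_sq_le_sq ?_ (Finset.sum_nonneg fun i _ => hv i)
  rw [EuclideanSpace.norm_sq_eq]
  simpa using Finset.sum_sq_le_sq_sum_of_nonneg fun i (_ : i ∈ Finset.univ) => hv i

/-- A Lipschitz map of Euclidean space into the set of nonnegative vectors of coordinate sum
at most `1`, which normalizes the positive part as soon as its coordinate sum is at least `c`. -/
noncomputable def positivePartNormalize (c : ℝ) (u : EuclideanSpace ℝ ι) : EuclideanSpace ℝ ι :=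
  (max (∑ i, max (u i) 0) c)⁻¹ • WithLp.toLp 2 fun i => max (u i) 0

lemma positivePartNormalize_apply (c : ℝ) (u : EuclideanSpace ℝ ι) (i : ι) :
    positivePartNormalize c u i = (max (∑ i, max (u i) 0) c)⁻¹ * max (u i) 0 := rfl

lemma positivePartNormalize_nonneg {c : ℝ} (hc : 0 < c) (u : EuclideanSpace ℝ ι) (i : ι) :
    0 ≤ positivePartNormalize c u i :=
  mul_nonneg (inv_nonneg.2 (hc.le.trans (le_max_right _ _))) (le_max_right _ _)

lemma sum_positivePartNormalize_le_one {c : ℝ} (hc : 0 < c) (u : EuclideanSpace ℝ ι) :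
    ∑ i, positivePartNormalize c u i ≤ 1 := by
  simp only [positivePartNormalize_apply, ← Finset.mul_sum]
  rw [inv_mul_le_iff₀ (hc.trans_le (le_max_right _ _)), mul_one]
  exact le_max_left _ _

lemma sum_positivePartNormalize_eq_one {c : ℝ} (hc : 0 < c) {u : EuclideanSpace ℝ ι}
    (hu : c ≤ ∑ i, max (u i) 0) :
    ∑ i, positivePartNormalize c u i = 1 := by
  simp only [positivePartNormalize_apply, ← Finset.mul_sum, max_eq_left hu]
  exact inv_mul_cancel₀ (hc.trans_le hu).ne'

lemma norm_positivePartNormalize_le_one {c : ℝ} (hc : 0 < c) (u : EuclideanSpace ℝ ι) :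
    ‖positivePartNormalize c u‖ ≤ 1 :=
  (norm_toLp_le_sum (positivePartNormalize_nonneg hc u)).trans
    (sum_positivePartNormalize_le_one hc u)

lemma positivePartNormalize_eq_self {u : EuclideanSpace ℝ ι} (hu : ∀ i, 0 ≤ u i)
    (hsum : ∑ i, u i = 1) : positivePartNormalize 1 u = u := by
  ext i
  simp [positivePartNormalize_apply, hu, hsum]

lemma exists_lipschitzWith_positivePartNormalize {c : ℝ} (hc : 0 < c) :
    ∃ K, LipschitzWith K (positivePartNormalize c : EuclideanSpace ℝ ι → EuclideanSpace ℝ ι) := by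
  have hcoord : ∀ i, LipschitzWith 1 fun u : EuclideanSpace ℝ ι => max (u i) 0 := fun i => by
    refine LipschitzWith.max_const ?_ 0
    simpa [Function.comp_def] using
      (LipschitzWith.eval i).comp (PiLp.lipschitzWith_ofLp 2 fun _ : ι => ℝ)
  obtain ⟨K, hK⟩ := exists_lipschitzWith_toLp hcoord
  exact hK.exists_inv_smul ((lipschitzWith_finset_sum hcoord).max_const c) hc
    (fun _ => le_max_right _ _)
    fun u => (norm_toLp_le_sum fun _ => le_max_right _ _).trans (le_max_left _ _)

end Simplex

/-- A continuous self-map of a compact convex set has approximate fixed points. -/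
lemma exists_dist_map_self_le {X : Type*} [NormedAddCommGroup X] [NormedSpace ℝ X]
    {K : Set X} (hK : IsCompact K) (hcv : Convex ℝ K) (hne : K.Nonempty) {T : X → X}
    (hmap : MapsTo T K K) (hT : ContinuousOn T K) {ε : ℝ} (hε : 0 < ε) :
    ∃ x ∈ K, dist (T x) x ≤ ε := by
  obtain ⟨p, hp⟩ := hne
  obtain ⟨δ, hδ, hTδ⟩ :=
    Metric.uniformContinuousOn_iff.1 (hK.uniformContinuousOn_of_continuous hT) ε hε
  obtain ⟨t, htK, ht, hcov⟩ := Metric.finite_approx_of_totallyBounded hK.totallyBounded δ hδ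
  have := ht.fintype
  -- Lipschitz bump functions centred at the points of the `δ`-net `t`
  let ψ : X → EuclideanSpace ℝ t := fun x => WithLp.toLp 2 fun i => δ - dist x i
  obtain ⟨Kψ, hψ⟩ : ∃ C, LipschitzWith C ψ := exists_lipschitzWith_toLp (K := 1) fun i => by
    simpa using (LipschitzWith.const δ).sub (LipschitzWith.dist_left (i : X))
  obtain ⟨c, hc, hcψ⟩ : ∃ c, 0 < c ∧ ∀ x ∈ K, c ≤ ∑ i, max (ψ x i) 0 := by
    obtain ⟨z, hz, hmin⟩ := hK.exists_isMinOn ⟨p, hp⟩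
      (f := fun x => ∑ i, max (ψ x i) 0) (by
        simp only [ψ]
        fun_prop)
    refine ⟨_, ?_, fun x hx => hmin hx⟩
    obtain ⟨y, hy, hzy⟩ := mem_iUnion₂.1 (hcov hz)
    refine Finset.sum_pos' (fun _ _ => le_max_right _ _) ⟨⟨y, hy⟩, Finset.mem_univ _, ?_⟩
    exact lt_max_of_lt_left (sub_pos.2 hzy)
  let L : EuclideanSpace ℝ t →L[ℝ] X := ∑ i, (EuclideanSpace.proj i).smulRight (T i - p)
  have hL : ∀ y, L y = ∑ i, y i • (T i - p) := fun y => by simp [L]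
  let A : EuclideanSpace ℝ t → X := fun y => p + L (positivePartNormalize 1 y)
  have hAK : ∀ y, A y ∈ K := by
    intro y
    have hw := positivePartNormalize_nonneg one_pos y
    have hs := sum_positivePartNormalize_le_one one_pos y
    have hmem := hcv.sum_mem (t := Finset.univ)
      (w := fun o : Option t => o.elim (1 - ∑ i, positivePartNormalize 1 y i)
        (positivePartNormalize 1 y)) (z := fun o => o.elim p fun i => T i)
      (by rintro (_ | i) - <;> simp [hw, hs]) (by simp [Fintype.sum_option])
      (by rintro (_ | i) -; exacts [hp, hmap (htK i.2)])
    convert hmem using 1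
    simp only [A, hL, Fintype.sum_option, Option.elim, smul_sub, Finset.sum_sub_distrib,
      sub_smul, one_smul, Finset.sum_smul]
    abel
  obtain ⟨K₁, hK₁⟩ := exists_lipschitzWith_positivePartNormalize (ι := t) one_pos
  obtain ⟨K₂, hK₂⟩ := exists_lipschitzWith_positivePartNormalize (ι := t) hc
  have hA : LipschitzWith (0 + _) A := (LipschitzWith.const p).add (L.lipschitz.comp hK₁)
  obtain ⟨y, hy⟩ := (hK₂.comp (hψ.comp hA)).exists_fixedPoint_of_norm_le_one
    fun y => norm_positivePartNormalize_le_one hc _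
  have hy : positivePartNormalize c (ψ (A y)) = y := hy
  have hy0 : ∀ i, 0 ≤ y i := fun i => hy ▸ positivePartNormalize_nonneg hc _ i
  have hy1 : ∑ i, y i = 1 := by
    have := sum_positivePartNormalize_eq_one hc (hcψ _ (hAK y))
    rwa [hy] at this
  have hAy : A y = ∑ i, y i • T i := by
    simp only [A, hL, positivePartNormalize_eq_self hy0 hy1, smul_sub, Finset.sum_sub_distrib,
      ← Finset.sum_smul, hy1]
    simp
  refine ⟨A y, hAK y, ?_⟩
  have hdiff : A y - T (A y) = ∑ i, y i • (T i - T (A y)) := by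
    simp only [smul_sub, Finset.sum_sub_distrib, ← Finset.sum_smul, hy1, one_smul, ← hAy]
  rw [dist_comm, dist_eq_norm, hdiff]
  calc ‖∑ i, y i • (T i - T (A y))‖ ≤ ∑ i, y i * ε := by
        refine norm_sum_le_of_le _ fun i _ => ?_
        rw [norm_smul, Real.norm_of_nonneg (hy0 i)]
        rcases lt_or_ge (dist (i : X) (A y)) δ with h | h
        · rw [← dist_eq_norm]
          exact mul_le_mul_of_nonneg_left (hTδ _ (htK i.2) _ (hAK y) h).le (hy0 i)
        · have : y i = 0 := by
            have hψi : ψ (A y) i ≤ 0 := by simpa [ψ, dist_comm] using h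
            rw [← hy, positivePartNormalize_apply, max_eq_right hψi, mul_zero]
          simp [this]
    _ = ε := by rw [← Finset.sum_mul, hy1, one_mul]

/-- Schauder's fixed point theorem. -/
theorem schauder_fixed_point {X : Type*} [NormedAddCommGroup X] [NormedSpace ℝ X]
    {K : Set X} (hK : IsCompact K) (hcv : Convex ℝ K) (hne : K.Nonempty) {T : X → X}
    (hmap : MapsTo T K K) (hT : ContinuousOn T K) : ∃ x ∈ K, T x = x := by
  obtain ⟨z, hz, hmin⟩ := hK.exists_isMinOn hne 
    (continuous_dist.comp_continuousOn (hT.prodMk continuousOn_id))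
  refine ⟨z, hz, dist_le_zero.1 (le_of_forall_pos_le_add fun ε hε => ?_)⟩
  obtain ⟨x, hx, hxε⟩ := exists_dist_map_self_le hK hcv hne hmap hT hε
  rw [zero_add]
  exact (hmin hx).trans hxε

lemma hausdorffMNC_nonneg {X : Type*} [NormedAddCommGroup X] (A : Set X) :
    0 ≤ hausdorffMNC A :=
  Real.sInf_nonneg fun _ h => h.1.le

/-- A finite cover by balls of radius `r` bounds the measure of noncompactness. -/
lemma hausdorffMNC_le_of_finite_cover {X : Type*} [NormedAddCommGroup X] {A : Set X} {r : ℝ}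
    (hr : 0 < r) {t : Set X} (ht : t.Finite) (hA : A ⊆ ⋃ x ∈ t, ball x r) :
    hausdorffMNC A ≤ r := by
  refine le_of_forall_gt_imp_ge_of_dense fun s hs => ?_
  refine csInf_le ⟨0, fun _ h => h.1.le⟩ ⟨hr.trans hs, ?_⟩
  obtain ⟨n, c, -, rfl⟩ := ht.fin_param
  rw [biUnion_range] at hA
  exact ⟨n, c, fun _ => r, fun _ => hs, hA⟩

/-- A bounded set is covered by finitely many balls of any radius above its measure of
noncompactness. -/
lemma exists_finite_cover_of_hausdorffMNC_lt {X : Type*} [NormedAddCommGroup X] {A : Set X}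
    (hA : Bornology.IsBounded A) {r : ℝ} (hr : hausdorffMNC A < r) :
    ∃ t : Set X, t.Finite ∧ A ⊆ ⋃ x ∈ t, ball x r := by
  have hne : {ε : ℝ | 0 < ε ∧ ∃ (n : ℕ) (c : Fin n → X) (ρ : Fin n → ℝ),
      (∀ i, ρ i < ε) ∧ A ⊆ ⋃ i, Metric.ball (c i) (ρ i)}.Nonempty := by
    obtain ⟨R, hR, hAR⟩ := hA.subset_ball_lt 0 (0 : X)
    exact ⟨R + 1, by linarith, 1, fun _ => 0, fun _ => R, fun _ => by linarith,
      hAR.trans (subset_iUnion (fun _ : Fin 1 => ball (0 : X) R) 0)⟩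
  obtain ⟨ε, ⟨-, n, c, ρ, hρ, hcov⟩, hε⟩ := exists_lt_of_csInf_lt hne hr
  refine ⟨range c, finite_range c, hcov.trans ?_⟩
  rw [biUnion_range]
  exact iUnion_mono fun i => ball_subset_ball ((hρ i).trans hε).le

open scoped Pointwise in
/-- Passing to the closed convex hull enlarges the radius of a finite cover by balls by an
arbitrarily small amount. -/
lemma exists_finite_cover_closure_convexHull {X : Type*} [NormedAddCommGroup X]
    [NormedSpace ℝ X] {A : Set X} {r s : ℝ} (hrs : r < s)
    (hA : ∃ t : Set X, t.Finite ∧ A ⊆ ⋃ x ∈ t, ball x r) :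
    ∃ t : Set X, t.Finite ∧ closure (convexHull ℝ A) ⊆ ⋃ x ∈ t, ball x s := by
  obtain ⟨t, ht, hcov⟩ := hA
  obtain ⟨u, -, hu, htu⟩ := Metric.finite_approx_of_totallyBounded
    (ht.isCompact_convexHull ℝ).totallyBounded ((s - r) / 2) (by linarith)
  refine ⟨u, hu, ?_⟩
  have hconv : convexHull ℝ A ⊆ convexHull ℝ t + ball 0 r := by
    refine convexHull_min (fun a ha => ?_) ((convex_convexHull ℝ t).add (convex_ball 0 r))
    obtain ⟨x, hx, hax⟩ := mem_iUnion₂.1 (hcov ha)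
    exact ⟨x, subset_convexHull ℝ t hx, a - x, by simpa [dist_eq_norm] using hax, by simp⟩
  intro y hy
  obtain ⟨z, hz, hyz⟩ := Metric.mem_closure_iff.1 hy ((s - r) / 2) (by linarith)
  obtain ⟨p, hp, q, hq, rfl⟩ := hconv hz
  obtain ⟨x, hx, hpx⟩ := mem_iUnion₂.1 (htu hp)
  refine mem_iUnion₂.2 ⟨x, hx, ?_⟩
  rw [mem_ball] at hpx ⊢
  have hqr : dist (p + q) p < r := by simpa [dist_eq_norm] using hq
  calc dist y x ≤ dist y (p + q) + dist (p + q) p + dist p x := dist_triangle4 _ _ _ _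
    _ < s := by linarith

/-- Darbo's fixed point theorem: if `E` is a nonempty, bounded, closed and convex subset
of a real Banach space `X` and `T : E → E` is continuous with
`χ(T(A)) ≤ k·χ(A)` for some `k ∈ [0,1)` and every nonempty `A ⊆ E`, then `T` has a
fixed point in `E`. -/
theorem darbo_fixed_point
    {X : Type*} [NormedAddCommGroup X] [NormedSpace ℝ X] [CompleteSpace X]
    (E : Set X) (hne : E.Nonempty) (hbdd : Bornology.IsBounded E)
    (hcl : IsClosed E) (hcv : Convex ℝ E)
    (T : X → X) (hmap : Set.MapsTo T E E) (hcont : ContinuousOn T E)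
    (k : ℝ) (hk0 : 0 ≤ k) (hk1 : k < 1)
    (hdarbo : ∀ A : Set X, A ⊆ E → A.Nonempty →
      hausdorffMNC (T '' A) ≤ k * hausdorffMNC A) :
    ∃ x ∈ E, T x = x := by
  obtain ⟨x₀, hx₀⟩ := hne
  -- the smallest closed convex `T`-invariant subset of `E` containing `x₀`
  let F : Set (Set X) := {C | IsClosed C ∧ Convex ℝ C ∧ x₀ ∈ C ∧ C ⊆ E ∧ MapsTo T C C}
  let K : Set X := ⋂₀ F
  have hKE : K ⊆ E := sInter_subset_of_mem ⟨hcl, hcv, hx₀, Subset.rfl, hmap⟩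
  have hKcl : IsClosed K := isClosed_sInter fun C hC => hC.1
  have hKcv : Convex ℝ K := convex_sInter fun C hC => hC.2.1
  have hxK : x₀ ∈ K := fun C hC => hC.2.2.1
  have hKmap : MapsTo T K K := fun x hx C hC => hC.2.2.2.2 (hx C hC)
  have hsub : closure (convexHull ℝ (insert x₀ (T '' K))) ⊆ K :=
    closure_minimal (convexHull_min (insert_subset hxK hKmap.image_subset) hKcv) hKcl
  have hgen : K ⊆ closure (convexHull ℝ (insert x₀ (T '' K))) := by
    have hin : insert x₀ (T '' K) ⊆ closure (convexHull ℝ (insert x₀ (T '' K))) :=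
      (subset_convexHull ℝ _).trans subset_closure
    exact sInter_subset_of_mem ⟨isClosed_closure, (convex_convexHull ℝ _).closure,
      hin (mem_insert _ _), hsub.trans hKE,
      fun x hx => hin (mem_insert_of_mem _ (mem_image_of_mem T (hsub hx)))⟩
  have hKb : Bornology.IsBounded K := hbdd.subset hKE
  have hzero : hausdorffMNC K = 0 := by
    by_contra hne
    have hpos : 0 < hausdorffMNC K := lt_of_le_of_ne (hausdorffMNC_nonneg K) (Ne.symm hne)
    have hlt : hausdorffMNC (T '' K) < hausdorffMNC K :=
      (hdarbo K hKE ⟨x₀, hxK⟩).trans_lt (by nlinarith)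
    obtain ⟨r, hr, hrK⟩ := exists_between hlt
    obtain ⟨s, hrs, hsK⟩ := exists_between hrK
    have hr0 : 0 < r := (hausdorffMNC_nonneg _).trans_lt hr
    obtain ⟨t, ht, htcov⟩ :=
      exists_finite_cover_of_hausdorffMNC_lt (hKb.subset hKmap.image_subset) hr
    obtain ⟨u, hu, hucov⟩ := exists_finite_cover_closure_convexHull (A := insert x₀ (T '' K)) hrs
      ⟨insert x₀ t, ht.insert x₀, by
        rw [biUnion_insert]
        exact insert_subset (Or.inl (mem_ball_self hr0))
          (htcov.trans subset_union_right)⟩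
    exact hsK.not_ge (hausdorffMNC_le_of_finite_cover (hr0.trans hrs) hu (hgen.trans hucov))
  have hKc : IsCompact K := by
    refine isCompact_iff_totallyBounded_isComplete.2
      ⟨Metric.totallyBounded_iff.2 fun ε hε => ?_, hKcl.isComplete⟩
    exact exists_finite_cover_of_hausdorffMNC_lt hKb (hzero ▸ hε)
  obtain ⟨x, hx, hfix⟩ := schauder_fixed_point hKc hKcv ⟨x₀, hxK⟩ hKmap (hcont.mono hKE)
  exact ⟨x, hKE hx, hfix⟩
end

section
/- For every nonempty bounded subset E of ℓ_p (1 ≤ p < ∞), the Hausdorff measure of noncompactness of E is given by χ(E) = lim_{n→∞} sup_{x∈E} (∑_{k≥n} |x_k|^p)^{1/p}, where χ(E) = inf{ε > 0 : E can be covered by finitely many open balls of ℓ_p of radii < ε} (the limit exists since the suprema are nonincreasing in n and bounded below by 0). -/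
open Set Metric Filter
open scoped ENNReal Topology

/-- The `n`-th tail of `x`: its first `n` coordinates are replaced by zero. -/
noncomputable def lpTail {p : ℝ≥0∞} (n : ℕ) (x : lp (fun _ : ℕ => ℝ) p) :
    lp (fun _ : ℕ => ℝ) p :=
  x - ∑ i ∈ Finset.range n, lp.single p i (x i)

lemma lpTail_sub {p : ℝ≥0∞} (n : ℕ) (x y : lp (fun _ : ℕ => ℝ) p) :
    lpTail n (x - y) = lpTail n x - lpTail n y := by
  simp only [lpTail, lp.coeFn_sub, Pi.sub_apply, lp.single_sub, Finset.sum_sub_distrib]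
  abel

section lpTail

variable {p : ℝ≥0∞} [Fact (1 ≤ p)]

lemma toReal_pos_of_one_le (hp : p ≠ ∞) : 0 < p.toReal :=
  ENNReal.toReal_pos (zero_lt_one.trans_le Fact.out).ne' hp

lemma norm_lpTail_eq (hp : p ≠ ∞) (n : ℕ) (x : lp (fun _ : ℕ => ℝ) p) :
    ‖lpTail n x‖ = (∑' k : ℕ, |x (n + k)| ^ p.toReal) ^ (1 / p.toReal) := by
  have hp0 := toReal_pos_of_one_le hp
  have hsplit := ((lp.memℓp x).summable hp0).sum_add_tsum_nat_add n
  have hnorm := lp.norm_compl_sum_single hp0 x (Finset.range n)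
  rw [lp.norm_rpow_eq_tsum hp0 x, ← hsplit, add_sub_cancel_left] at hnorm
  simp only [Real.norm_eq_abs, add_comm _ n] at hnorm
  rw [← hnorm, one_div, Real.rpow_rpow_inv (norm_nonneg _) hp0.ne', lpTail]

lemma norm_lpTail_le (hp : p ≠ ∞) (n : ℕ) (x : lp (fun _ : ℕ => ℝ) p) :
    ‖lpTail n x‖ ≤ ‖x‖ := by
  have hp0 := toReal_pos_of_one_le hp
  refine (Real.rpow_le_rpow_iff (norm_nonneg _) (norm_nonneg _) hp0).1 ?_
  rw [lpTail, lp.norm_compl_sum_single hp0]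
  exact sub_le_self _ (Finset.sum_nonneg fun i _ => by positivity)

lemma tendsto_norm_lpTail (hp : p ≠ ∞) (x : lp (fun _ : ℕ => ℝ) p) :
    Tendsto (fun n => ‖lpTail n x‖) atTop (𝓝 0) := by
  have h := (lp.hasSum_single hp x).tendsto_sum_nat.const_sub x
  rw [sub_self] at h
  simpa [lpTail] using h.norm

/-- The truncations of a bounded set to the first `n` coordinates lie in a compact set. -/
lemma totallyBounded_image_sub_lpTail (n : ℕ) {E : Set (lp (fun _ : ℕ => ℝ) p)}
    (hE : Bornology.IsBounded E) : TotallyBounded ((fun x => x - lpTail n x) '' E) := by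
  obtain ⟨R, hR⟩ := hE.exists_norm_le
  let B : (Fin n → ℝ) → lp (fun _ : ℕ => ℝ) p := fun y =>
    ∑ i : Fin n, lp.single p (i : ℕ) (y i)
  have hB : Continuous B := continuous_finsetSum _ fun i _ =>
    (lp.isometry_single (E := fun _ : ℕ => ℝ) (p := p) (i : ℕ)).continuous.comp
      (continuous_apply i)
  have hK : IsCompact (B '' univ.pi fun _ => closedBall 0 R) :=
    (isCompact_univ_pi fun _ => isCompact_closedBall 0 R).image hB
  refine hK.totallyBounded.subset ?_
  rintro _ ⟨x, hx, rfl⟩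
  refine ⟨fun i => x i, fun i _ => ?_, ?_⟩
  · rw [mem_closedBall_zero_iff]
    exact (lp.norm_apply_le_norm (zero_lt_one.trans_le Fact.out).ne' x i).trans (hR x hx)
  · simp only [B, lpTail, sub_sub_cancel]
    exact Fin.sum_univ_eq_sum_range (fun i => lp.single p i (x i)) n

/-- If the `n`-th tails of a bounded set are bounded by `s`, then the set has finite covers by
balls of any radius larger than `s`. -/
lemma exists_finite_cover_of_norm_lpTail_le {E : Set (lp (fun _ : ℕ => ℝ) p)}
    (hE : Bornology.IsBounded E) {n : ℕ} {s r : ℝ} (hs : ∀ x ∈ E, ‖lpTail n x‖ ≤ s)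
    (hr : s < r) :
    ∃ (m : ℕ) (c : Fin m → lp (fun _ : ℕ => ℝ) p), E ⊆ ⋃ i, ball (c i) r := by
  obtain ⟨t, ht, hcov⟩ := Metric.totallyBounded_iff.1 (totallyBounded_image_sub_lpTail n hE)
    (r - s) (sub_pos.2 hr)
  obtain ⟨m, c, -, hc⟩ := ht.fin_param
  refine ⟨m, c, fun x hx => ?_⟩
  obtain ⟨y, hy, hxy⟩ := mem_iUnion₂.1 (hcov (mem_image_of_mem _ hx))
  rw [← hc] at hy
  obtain ⟨i, rfl⟩ := hy
  refine mem_iUnion.2 ⟨i, ?_⟩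
  rw [mem_ball, dist_eq_norm] at hxy ⊢
  have htri := norm_add_le (lpTail n x) (x - lpTail n x - c i)
  rw [show lpTail n x + (x - lpTail n x - c i) = x - c i by abel] at htri
  linarith [hs x hx]

/-- If a set has a finite cover by balls of radii less than `ε`, then its tails are eventually
bounded by any number larger than `ε`. -/
lemma eventually_norm_lpTail_le_of_cover (hp : p ≠ ∞) {E : Set (lp (fun _ : ℕ => ℝ) p)} {m : ℕ}
    {c : Fin m → lp (fun _ : ℕ => ℝ) p} {ρ : Fin m → ℝ} {ε b : ℝ} (hρ : ∀ i, ρ i < ε)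
    (hcov : E ⊆ ⋃ i, ball (c i) (ρ i)) (hb : ε < b) :
    ∀ᶠ n in atTop, ∀ x ∈ E, ‖lpTail n x‖ ≤ b := by
  have hc : ∀ᶠ n in atTop, ∀ i, ‖lpTail n (c i)‖ < b - ε :=
    eventually_all.2 fun i => (tendsto_norm_lpTail hp (c i)).eventually_lt_const (sub_pos.2 hb)
  filter_upwards [hc] with n hn x hx
  obtain ⟨i, hi⟩ := mem_iUnion.1 (hcov hx)
  rw [mem_ball, dist_eq_norm] at hi
  have htail := norm_lpTail_le hp n (x - c i)
  rw [lpTail_sub] at htail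
  linarith [norm_le_norm_add_norm_sub' (lpTail n x) (lpTail n (c i)), hn i, hρ i]

end lpTail

/-- For every nonempty bounded subset `E` of `ℓ_p` (`1 ≤ p < ∞`), the Hausdorff measure
of noncompactness of `E` is `χ(E) = lim_{n→∞} sup_{x∈E} (∑_{k≥n} |x_k|^p)^{1/p}`:
the sequence of suprema converges and its limit is `χ(E)`. -/
theorem hausdorffMNC_lp_formula
    (p : ℝ≥0∞) [Fact (1 ≤ p)] (hp : p ≠ ∞)
    (E : Set (lp (fun _ : ℕ => ℝ) p)) (hne : E.Nonempty)
    (hbdd : Bornology.IsBounded E) :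
    Filter.Tendsto
      (fun n : ℕ => ⨆ x ∈ E, (∑' k : ℕ, |x (n + k)| ^ p.toReal) ^ (1 / p.toReal))
      Filter.atTop (nhds (hausdorffMNC E)) := by
  simp_rw [← norm_lpTail_eq hp]
  obtain ⟨R, hR⟩ := hbdd.exists_norm_le
  have hR0 : 0 ≤ R := hne.elim fun x hx => (norm_nonneg x).trans (hR x hx)
  have hle : ∀ n, ∀ x ∈ E, ‖lpTail n x‖ ≤ ⨆ x ∈ E, ‖lpTail n x‖ := fun n x hx => by
    have hbd : BddAbove (range fun x => ⨆ _ : x ∈ E, ‖lpTail n x‖) :=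
      ⟨R, forall_mem_range.2 fun y =>
        Real.iSup_le (fun hy => (norm_lpTail_le hp n y).trans (hR y hy)) hR0⟩
    simpa [hx] using le_ciSup hbd x
  have hsup : ∀ n, 0 ≤ ⨆ x ∈ E, ‖lpTail n x‖ := fun n =>
    Real.iSup_nonneg fun x => Real.iSup_nonneg fun _ => norm_nonneg _
  have hmem : ∀ n r, (⨆ x ∈ E, ‖lpTail n x‖) < r → r ∈ {ε : ℝ | 0 < ε ∧
      ∃ (n : ℕ) (c : Fin n → lp (fun _ : ℕ => ℝ) p) (ρ : Fin n → ℝ),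
        (∀ i, ρ i < ε) ∧ E ⊆ ⋃ i, Metric.ball (c i) (ρ i)} := fun n r hr => by
    obtain ⟨r', hr', hr'r⟩ := exists_between hr
    obtain ⟨m, c, hc⟩ := exists_finite_cover_of_norm_lpTail_le hbdd (hle n) hr'
    exact ⟨(hsup n).trans_lt hr, m, c, fun _ => r', fun _ => hr'r, hc⟩
  have hlower : ∀ n, hausdorffMNC E ≤ ⨆ x ∈ E, ‖lpTail n x‖ := fun n =>
    le_of_forall_gt_imp_ge_of_dense fun r hr =>
      csInf_le ⟨0, fun _ hε => hε.1.le⟩ (hmem n r hr)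
  refine tendsto_order.2 ⟨fun a ha => .of_forall fun n => ha.trans_le (hlower n), fun b hb => ?_⟩
  obtain ⟨ε, ⟨hε0, m, c, ρ, hρ, hcov⟩, hεb⟩ :=
    exists_lt_of_csInf_lt ⟨_, hmem 0 _ (lt_add_one _)⟩ hb
  obtain ⟨b', hεb', hb'b⟩ := exists_between hεb
  have hb'0 : 0 ≤ b' := (hε0.trans hεb').le
  filter_upwards [eventually_norm_lpTail_le_of_cover hp hρ hcov hεb'] with n hn
  exact (Real.iSup_le (fun x => Real.iSup_le (hn x) hb'0) hb'0).trans_lt hb'b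
end
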